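/- Assume in addition that ρ is continuously differentiable and let ‖ρ'‖_∞ = sup_{z ∈ [0,1]} |ρ'(z)|, and let M ≥ 0 and α ∈ [0,1]. Let x ∈ ℝⁿ have nondecreasing entries in [0,1], and on a probability space let g be an integrable random vector in ℝⁿ with E[g] = ∇Q(x) and ‖g‖₂² ≤ 64(ρ_max + M)⁴ almost surely; set β = α/(16(ρ_max + M)²) and suppose that x − βg has nondecreasing entries in [0,1] almost surely. Then E[Q(x − βg)] − Q(x*) ≤ (1 − α/(4n²(ρ_max + M)²))·(Q(x) − Q(x*)) + (4ρ_max² + 2‖ρ'‖_∞ ρ_max)·α²/4, where x* is the unique global minimizer of Q. -/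

import Mathlib

open intervalIntegral MeasureTheory

/-- `F(x) = ∫₀ˣ ρ(z) dz`. -/
noncomputable def Fint (ρ : ℝ → ℝ) (t : ℝ) : ℝ := ∫ z in (0 : ℝ)..t, ρ z

/-- The Lyapunov function
`Q(x₁,…,xₙ) = 2 F(x₁)² + Σ_{i=1}^{n-1} (F(x_{i+1}) - F(x_i))² + 2 (F(1) - F(xₙ))²`,
for `n+1` agents. -/
noncomputable def Qfun (ρ : ℝ → ℝ) (n : ℕ) (x : EuclideanSpace ℝ (Fin (n + 1))) : ℝ :=
  2 * (Fint ρ (x 0)) ^ 2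
    + (∑ i : Fin n, (Fint ρ (x i.succ) - Fint ρ (x i.castSucc)) ^ 2)
    + 2 * (Fint ρ 1 - Fint ρ (x (Fin.last n))) ^ 2

/-- First-order part of the quadratic form behind `Qfun`. -/
noncomputable def Bform {n : ℕ} (c : ℝ) (u w : Fin (n + 1) → ℝ) : ℝ :=
  4 * u 0 * w 0 + (∑ i : Fin n, 2 * (u i.succ - u i.castSucc) * (w i.succ - w i.castSucc))
    - 4 * (c - u (Fin.last n)) * w (Fin.last n)

/-- Second-order part of the quadratic form behind `Qfun`. -/
noncomputable def Sform {n : ℕ} (w : Fin (n + 1) → ℝ) : ℝ :=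
  2 * w 0 ^ 2 + (∑ i : Fin n, (w i.succ - w i.castSucc) ^ 2) + 2 * w (Fin.last n) ^ 2

lemma Q_expand (ρ : ℝ → ℝ) (n : ℕ) (x y : EuclideanSpace ℝ (Fin (n + 1))) :
    Qfun ρ n y = Qfun ρ n x
      + Bform (Fint ρ 1) (fun i => Fint ρ (x i)) (fun i => Fint ρ (y i) - Fint ρ (x i))
      + Sform (fun i => Fint ρ (y i) - Fint ρ (x i)) := by
  have h : ∀ i : Fin n, (Fint ρ (y i.succ) - Fint ρ (y i.castSucc)) ^ 2
      = (Fint ρ (x i.succ) - Fint ρ (x i.castSucc)) ^ 2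
        + 2 * (Fint ρ (x i.succ) - Fint ρ (x i.castSucc)) *
          ((Fint ρ (y i.succ) - Fint ρ (x i.succ)) - (Fint ρ (y i.castSucc) - Fint ρ (x i.castSucc)))
        + ((Fint ρ (y i.succ) - Fint ρ (x i.succ))
          - (Fint ρ (y i.castSucc) - Fint ρ (x i.castSucc))) ^ 2 := by
    intro i; ring
  unfold Qfun Bform Sform
  rw [Finset.sum_congr rfl (fun i _ => h i), Finset.sum_add_distrib, Finset.sum_add_distrib]
  ring

/-- `Bform` as a linear map in its last argument. -/
noncomputable def Blin {n : ℕ} (c : ℝ) (u : Fin (n + 1) → ℝ) : (Fin (n + 1) → ℝ) →ₗ[ℝ] ℝ where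
  toFun := Bform c u
  map_add' := by
    intro v w
    have h : ∀ i : Fin n, 2 * (u i.succ - u i.castSucc) *
        ((v + w) i.succ - (v + w) i.castSucc)
        = 2 * (u i.succ - u i.castSucc) * (v i.succ - v i.castSucc)
          + 2 * (u i.succ - u i.castSucc) * (w i.succ - w i.castSucc) := by
      intro i; simp only [Pi.add_apply]; ring
    unfold Bform
    rw [Finset.sum_congr rfl (fun i _ => h i), Finset.sum_add_distrib]
    simp only [Pi.add_apply]; ring
  map_smul' := by
    intro a w
    have h : ∀ i : Fin n, 2 * (u i.succ - u i.castSucc) *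
        ((a • w) i.succ - (a • w) i.castSucc)
        = a * (2 * (u i.succ - u i.castSucc) * (w i.succ - w i.castSucc)) := by
      intro i; simp only [Pi.smul_apply, smul_eq_mul]; ring
    unfold Bform
    rw [Finset.sum_congr rfl (fun i _ => h i), ← Finset.mul_sum]
    simp only [Pi.smul_apply, smul_eq_mul, RingHom.id_apply]; ring

/-- Partial derivatives in the `u` variables. -/
noncomputable def pcoef {n : ℕ} (c : ℝ) (u : Fin (n + 1) → ℝ) (i : Fin (n + 1)) : ℝ :=
  Bform c u (Pi.single i 1)

lemma Bform_eq {n : ℕ} (c : ℝ) (u w : Fin (n + 1) → ℝ) :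
    Bform c u w = ∑ i, pcoef c u i * w i := by
  have h := LinearMap.pi_apply_eq_sum_univ (Blin c u) w
  have e : ∀ i : Fin (n + 1), (fun j => if i = j then (1 : ℝ) else 0) = Pi.single i 1 := by
    intro i; ext j; simp [Pi.single_apply, eq_comm]
  simp only [e, smul_eq_mul] at h
  change Bform c u w = ∑ i, w i * Bform c u (Pi.single i 1) at h
  rw [h]
  exact Finset.sum_congr rfl (fun i _ => mul_comm _ _)

lemma tele {n : ℕ} (u : Fin (n + 1) → ℝ) :
    ∑ i : Fin n, (u i.succ - u i.castSucc) = u (Fin.last n) - u 0 := by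
  have h1 := Fin.sum_univ_succ u
  have h2 := Fin.sum_univ_castSucc u
  rw [Finset.sum_sub_distrib]; linarith

lemma pcoef_bound {n : ℕ} (c : ℝ) (u : Fin (n + 1) → ℝ) (h0 : 0 ≤ u 0) (hc : u (Fin.last n) ≤ c)
    (hm : ∀ i j, i ≤ j → u i ≤ u j) (i : Fin (n + 1)) : |pcoef c u i| ≤ 4 * c := by
  have hw : ∀ j, 0 ≤ (Pi.single i 1 : Fin (n + 1) → ℝ) j ∧
      (Pi.single i 1 : Fin (n + 1) → ℝ) j ≤ 1 := by
    intro j; rw [Pi.single_apply]; split_ifs <;> norm_num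
  unfold pcoef Bform
  generalize (Pi.single i 1 : Fin (n + 1) → ℝ) = w at hw
  have hd : ∀ j : Fin n, 0 ≤ u j.succ - u j.castSucc := fun j =>
    sub_nonneg.2 (hm _ _ (Fin.castSucc_lt_succ).le)
  have t := tele u
  have hl := hm 0 (Fin.last n) (Fin.zero_le _)
  have S1 : ∑ j : Fin n, 2 * (u j.succ - u j.castSucc) * (w j.succ - w j.castSucc)
      ≤ 2 * (u (Fin.last n) - u 0) := by
    rw [← t, Finset.mul_sum]
    refine Finset.sum_le_sum fun j _ => ?_
    nlinarith [hd j, hw j.succ, hw j.castSucc]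
  have S2 : -(2 * (u (Fin.last n) - u 0))
      ≤ ∑ j : Fin n, 2 * (u j.succ - u j.castSucc) * (w j.succ - w j.castSucc) := by
    rw [← t, Finset.mul_sum, ← Finset.sum_neg_distrib]
    refine Finset.sum_le_sum fun j _ => ?_
    nlinarith [hd j, hw j.succ, hw j.castSucc]
  have a1 := mul_le_mul_of_nonneg_left (hw 0).2 h0
  have a2 := mul_nonneg h0 (hw 0).1
  have a3 := mul_le_mul_of_nonneg_left (hw (Fin.last n)).2 (sub_nonneg.2 hc)
  have a4 := mul_nonneg (sub_nonneg.2 hc) (hw (Fin.last n)).1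
  rw [abs_le]
  constructor <;> nlinarith

lemma Sform_le {n : ℕ} (w : Fin (n + 1) → ℝ) : Sform w ≤ 4 * ∑ i, w i ^ 2 := by
  have h1 := Fin.sum_univ_succ (fun i => w i ^ 2)
  have h2 := Fin.sum_univ_castSucc (fun i => w i ^ 2)
  have h3 : ∑ i : Fin n, (w i.succ - w i.castSucc) ^ 2
      ≤ 2 * ∑ i : Fin n, w i.succ ^ 2 + 2 * ∑ i : Fin n, w i.castSucc ^ 2 := by
    rw [Finset.mul_sum, Finset.mul_sum, ← Finset.sum_add_distrib]
    refine Finset.sum_le_sum fun j _ => ?_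
    nlinarith [sq_nonneg (w j.succ + w j.castSucc)]
  unfold Sform
  linarith

lemma Sform_aux : ∀ {n : ℕ} (w : Fin (n + 1) → ℝ) (i : Fin (n + 1)),
    w i ^ 2 ≤ (n + 1) * (w 0 ^ 2 + ∑ i : Fin n, (w i.succ - w i.castSucc) ^ 2) := by
  intro n
  induction n with
  | zero => intro w i; fin_cases i; simp
  | succ n ih =>
    intro w i
    rw [Fin.sum_univ_castSucc]
    set T := w 0 ^ 2 + ∑ i : Fin n, (w i.castSucc.succ - w i.castSucc.castSucc) ^ 2 with hT
    have hT0 : 0 ≤ T := by positivity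
    have ih' : ∀ j : Fin (n + 1), w j.castSucc ^ 2 ≤ (n + 1) * T := fun j => by
      exact ih (fun k => w k.castSucc) j
    have hn : (0 : ℝ) ≤ n := Nat.cast_nonneg n
    push_cast
    rw [← add_assoc, ← hT]
    induction i using Fin.lastCases with
    | cast j =>
      have := ih' j
      nlinarith [mul_nonneg hn (sq_nonneg (w (Fin.last n).succ - w (Fin.last n).castSucc)),
        sq_nonneg (w (Fin.last n).succ - w (Fin.last n).castSucc)]
    | last =>
      have h := ih' (Fin.last n)
      rw [Fin.succ_last]
      set a := w (Fin.last n).castSucc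
      set b := w (Fin.last (n + 1))
      set m : ℝ := n + 1 with hm
      have hm0 : 0 < m := by positivity
      -- m b² ≤ (m+1)(a² + m (b-a)²)
      have k : m * b ^ 2 ≤ m * ((m + 1) * (T + (b - a) ^ 2)) := by
        nlinarith [sq_nonneg (a - m * (b - a)), mul_le_mul_of_nonneg_left h (by linarith : 0 ≤ m + 1)]
      have := le_of_mul_le_mul_left k hm0
      linarith

lemma Sform_ge {n : ℕ} (w : Fin (n + 1) → ℝ) : ∑ i, w i ^ 2 ≤ ((n : ℝ) + 1) ^ 2 * Sform w := by
  have h : ∑ i, w i ^ 2 ≤ ∑ _i : Fin (n + 1), ((n : ℝ) + 1) * Sform w := by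
    refine Finset.sum_le_sum fun i _ => (Sform_aux w i).trans ?_
    apply mul_le_mul_of_nonneg_left _ (by positivity)
    unfold Sform
    nlinarith [sq_nonneg (w 0), sq_nonneg (w (Fin.last n))]
  simp at h
  linarith

lemma PL {n : ℕ} (c : ℝ) (u w : Fin (n + 1) → ℝ) :
    -(((n : ℝ) + 1) ^ 2 / 4 * ∑ i, pcoef c u i ^ 2) ≤ Bform c u w + Sform w := by
  have hS := Sform_ge w
  rw [Bform_eq]
  set N2 : ℝ := ((n : ℝ) + 1) ^ 2 with hN
  have hN0 : 0 < N2 := by positivity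
  have h : 0 ≤ ∑ i, (N2 * pcoef c u i + 2 * w i) ^ 2 := by positivity
  have e : ∑ i, (N2 * pcoef c u i + 2 * w i) ^ 2
      = N2 ^ 2 * ∑ i, pcoef c u i ^ 2 + 4 * N2 * ∑ i, pcoef c u i * w i + 4 * ∑ i, w i ^ 2 := by
    simp only [Finset.mul_sum, ← Finset.sum_add_distrib]
    exact Finset.sum_congr rfl fun i _ => by ring
  rw [e] at h
  have : 0 ≤ N2 * (N2 * ∑ i, pcoef c u i ^ 2 + 4 * ∑ i, pcoef c u i * w i + 4 * Sform w) := by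
    nlinarith
  have := nonneg_of_mul_nonneg_right this hN0
  linarith

lemma Fint_hasDeriv {ρ : ℝ → ℝ} (hc : Continuous ρ) (t : ℝ) : HasDerivAt (Fint ρ) (ρ t) t :=
  intervalIntegral.integral_hasDerivAt_right (hc.intervalIntegrable _ _)
    (hc.stronglyMeasurableAtFilter _ _) hc.continuousAt

lemma Fint_taylor {ρ : ℝ → ℝ} (hd : ContDiff ℝ 1 ρ) {K : ℝ}
    (hK : ∀ z ∈ Set.Icc (0 : ℝ) 1, |deriv ρ z| ≤ K) {a b : ℝ}
    (ha : a ∈ Set.Icc (0 : ℝ) 1) (hb : b ∈ Set.Icc (0 : ℝ) 1) :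
    |Fint ρ b - Fint ρ a - ρ a * (b - a)| ≤ K / 2 * (b - a) ^ 2 := by
  have hdiff : Differentiable ℝ ρ := hd.differentiable (by norm_num)
  have hseg : ∀ s ∈ Set.Icc (0 : ℝ) 1, a + s * (b - a) ∈ Set.Icc (0 : ℝ) 1 := by
    intro s hs
    have := (convex_Icc (0 : ℝ) 1).add_smul_sub_mem ha hb hs
    simpa using this
  have hf : ∀ s, HasDerivAt (fun s => Fint ρ (a + s * (b - a)) - Fint ρ a - s * (ρ a * (b - a)))
      (ρ (a + s * (b - a)) * (b - a) - ρ a * (b - a)) s := by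
    intro s
    have h1 : HasDerivAt (fun s : ℝ => a + s * (b - a)) (b - a) s := by
      simpa using ((hasDerivAt_id s).mul_const (b - a)).const_add a
    have h2 := (Fint_hasDeriv hdiff.continuous (a + s * (b - a))).comp s h1
    have h3 : HasDerivAt (fun s : ℝ => s * (ρ a * (b - a))) (ρ a * (b - a)) s := by
      simpa using (hasDerivAt_id s).mul_const (ρ a * (b - a))
    exact (h2.sub_const _).sub h3
  have hB : ∀ s, HasDerivAt (fun s : ℝ => K / 2 * (b - a) ^ 2 * s ^ 2)
      (K * (b - a) ^ 2 * s) s := by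
    intro s
    have := (hasDerivAt_pow 2 s).const_mul (K / 2 * (b - a) ^ 2)
    refine this.congr_deriv ?_
    norm_num; ring
  have := image_norm_le_of_norm_deriv_right_le_deriv_boundary (a := 0) (b := 1)
    (fun s _ => (hf s).continuousAt.continuousWithinAt)
    (fun s _ => (hf s).hasDerivWithinAt) (by simp) hB ?_ (Set.right_mem_Icc.2 zero_le_one)
  · simpa using this
  · intro s hs
    have hs' : s ∈ Set.Icc (0 : ℝ) 1 := ⟨hs.1, hs.2.le⟩
    have h := (convex_Icc (0 : ℝ) 1).norm_image_sub_le_of_norm_deriv_le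
      (fun z _ => hdiff z) hK ha (hseg s hs')
    rw [Real.norm_eq_abs, Real.norm_eq_abs, add_sub_cancel_left, abs_mul, abs_of_nonneg hs.1] at h
    rw [← sub_mul, Real.norm_eq_abs, abs_mul]
    calc _ ≤ K * (s * |b - a|) * |b - a| := mul_le_mul_of_nonneg_right h (abs_nonneg _)
      _ = K * |b - a| ^ 2 * s := by ring
      _ = _ := by rw [sq_abs]

lemma Q_grad {ρ : ℝ → ℝ} (hc : Continuous ρ) (n : ℕ) (x : EuclideanSpace ℝ (Fin (n + 1))) :
    HasGradientAt (Qfun ρ n)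
      (WithLp.toLp 2 fun i => pcoef (Fint ρ 1) (fun j => Fint ρ (x j)) i * ρ (x i)) x := by
  rw [hasGradientAt_iff_hasFDerivAt]
  have hF : ∀ i : Fin (n + 1), HasFDerivAt (fun y : EuclideanSpace ℝ (Fin (n + 1)) => Fint ρ (y i))
      (ρ (x i) • (EuclideanSpace.proj i : EuclideanSpace ℝ (Fin (n + 1)) →L[ℝ] ℝ)) x := by
    intro i
    exact (Fint_hasDeriv hc (x i)).comp_hasFDerivAt x
      ((EuclideanSpace.proj i : EuclideanSpace ℝ (Fin (n + 1)) →L[ℝ] ℝ).hasFDerivAt)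
  have h0 := ((hF 0).pow 2).const_mul 2
  have hl := (((hF (Fin.last n)).const_sub (Fint ρ 1)).pow 2).const_mul 2
  have hs := HasFDerivAt.fun_sum (u := Finset.univ) (fun (i : Fin n) _ =>
    ((hF i.succ).sub (hF i.castSucc)).pow 2)
  refine ((h0.add hs).add hl).congr_fderiv ?_
  ext h
  have hB := Bform_eq (Fint ρ 1) (fun j => Fint ρ (x j)) (fun i => ρ (x i) * h i)
  have e : ∑ i, pcoef (Fint ρ 1) (fun j => Fint ρ (x j)) i * (ρ (x i) * h i) =
      (InnerProductSpace.toDual ℝ (EuclideanSpace ℝ (Fin (n + 1))))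
        (WithLp.toLp 2 fun i => pcoef (Fint ρ 1) (fun j => Fint ρ (x j)) i * ρ (x i)) h := by
    rw [InnerProductSpace.toDual_apply_apply, PiLp.inner_apply]
    refine Finset.sum_congr rfl fun i _ => ?_
    simp; ring
  rw [← e, ← hB]
  unfold Bform
  simp
  have : ∀ a b c d : ℝ, a = c → b = d → a + b = c + d := by intros; simp [*]
  rw [sub_eq_add_neg]
  refine this _ _ _ _ (this _ _ _ _ ?_ (Finset.sum_congr rfl fun i _ => ?_)) ?_ <;> ring

lemma Q_step {ρ : ℝ → ℝ} (hd : ContDiff ℝ 1 ρ) {ρmax K : ℝ}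
    (hρ : ∀ z, 1 ≤ ρ z ∧ ρ z ≤ ρmax)
    (hK : ∀ z ∈ Set.Icc (0 : ℝ) 1, |deriv ρ z| ≤ K) (n : ℕ)
    (x y : EuclideanSpace ℝ (Fin (n + 1)))
    (hx01 : ∀ i, x i ∈ Set.Icc (0 : ℝ) 1) (hy01 : ∀ i, y i ∈ Set.Icc (0 : ℝ) 1)
    (hxmono : ∀ i j : Fin (n + 1), i ≤ j → x i ≤ x j) :
    Qfun ρ n y ≤ Qfun ρ n x + inner ℝ (gradient (Qfun ρ n) x) (y - x)
      + (4 * ρmax ^ 2 + 2 * K * ρmax) * ‖y - x‖ ^ 2 := by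
  have hc : Continuous ρ := hd.continuous
  have hdiff : Differentiable ℝ (Fint ρ) := fun t => (Fint_hasDeriv hc t).differentiableAt
  have hder : deriv (Fint ρ) = ρ := funext fun t => (Fint_hasDeriv hc t).deriv
  have hmono : Monotone (Fint ρ) := monotone_of_deriv_nonneg hdiff fun t => by
    rw [hder]; linarith [hρ t]
  have hF0 : Fint ρ 0 = 0 := by simp [Fint]
  have hlip : ∀ a b, |Fint ρ b - Fint ρ a| ≤ ρmax * |b - a| := by
    intro a b
    have := convex_univ.norm_image_sub_le_of_norm_deriv_le (f := Fint ρ) (C := ρmax)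
      (fun z _ => hdiff z) (fun z _ => by
        rw [hder, Real.norm_eq_abs, abs_of_nonneg] <;> linarith [hρ z])
      (Set.mem_univ a) (Set.mem_univ b)
    simpa using this
  have hF1 : Fint ρ 1 ≤ ρmax := by
    have := (le_abs_self _).trans (hlip 0 1)
    simpa [hF0] using this
  have hK0 : 0 ≤ K := (abs_nonneg _).trans (hK 0 (by simp))
  have hp := pcoef_bound (Fint ρ 1) (fun j => Fint ρ (x j))
    (by rw [← hF0]; exact hmono (hx01 0).1) (hmono (hx01 _).2)
    (fun i j hij => hmono (hxmono i j hij))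
  rw [Q_expand ρ n x y, (Q_grad hc n x).gradient, EuclideanSpace.norm_sq_eq, PiLp.inner_apply,
    Bform_eq]
  have hS := Sform_le (fun i => Fint ρ (y i) - Fint ρ (x i))
  have h1 : ∑ i, (Fint ρ (y i) - Fint ρ (x i)) ^ 2 ≤ ρmax ^ 2 * ∑ i, ‖(y - x) i‖ ^ 2 := by
    rw [Finset.mul_sum]
    refine Finset.sum_le_sum fun i _ => ?_
    have := pow_le_pow_left₀ (abs_nonneg _) (hlip (x i) (y i)) 2
    rw [sq_abs, mul_pow] at this
    simpa using this
  have h2 : ∑ i, pcoef (Fint ρ 1) (fun j => Fint ρ (x j)) i * (Fint ρ (y i) - Fint ρ (x i))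
      ≤ ∑ i, inner ℝ ((WithLp.toLp 2 fun i => pcoef (Fint ρ 1) (fun j => Fint ρ (x j)) i * ρ (x i) :
          EuclideanSpace ℝ (Fin (n + 1))) i) ((y - x) i)
        + 2 * K * ρmax * ∑ i, ‖(y - x) i‖ ^ 2 := by
    rw [Finset.mul_sum, ← Finset.sum_add_distrib]
    refine Finset.sum_le_sum fun i _ => ?_
    have ht := Fint_taylor hd hK (hx01 i) (hy01 i)
    have hpi : |pcoef (Fint ρ 1) (fun j => Fint ρ (x j)) i| ≤ 4 * ρmax := (hp i).trans (by linarith)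
    have hm := mul_le_mul hpi ht (abs_nonneg _) ((abs_nonneg _).trans hpi)
    rw [← abs_mul] at hm
    have := (le_abs_self _).trans hm
    simp
    nlinarith
  linarith

/-- (One-step expected decrease.)  Let `ρ` be continuously
differentiable with `K = sup_{z ∈ [0,1]} |ρ'(z)|`, `M ≥ 0`, `α ∈ [0,1]`, and let `x` be a
monotone configuration in `[0,1]ⁿ`.  If `g` is an integrable random vector with
`E[g] = ∇Q(x)`, `‖g‖₂² ≤ 64(ρmax+M)⁴` a.s., and (with `β = α/(16(ρmax+M)²)`) `x - βg`
is a.s. a monotone configuration in `[0,1]ⁿ`, then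
`E[Q(x - βg)] - Q(x*) ≤ (1 - α/(4n²(ρmax+M)²))(Q(x) - Q(x*)) + (4ρmax² + 2Kρmax)α²/4`. -/
theorem stmt16 (n : ℕ) (ρ : ℝ → ℝ) (ρmax M α : ℝ) (hρmax : 1 ≤ ρmax) (hM : 0 ≤ M)
    (hα0 : 0 ≤ α) (hα1 : α ≤ 1)
    (hρdiff : ContDiff ℝ 1 ρ) (hρ : ∀ z, 1 ≤ ρ z ∧ ρ z ≤ ρmax)
    (K : ℝ) (hK : K = ⨆ z : Set.Icc (0 : ℝ) 1, |deriv ρ (z : ℝ)|)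
    (xs : EuclideanSpace ℝ (Fin (n + 1)))
    (hmin : ∀ y, Qfun ρ n xs ≤ Qfun ρ n y)
    (x : EuclideanSpace ℝ (Fin (n + 1)))
    (hx01 : ∀ i, x i ∈ Set.Icc (0 : ℝ) 1)
    (hxmono : ∀ i j : Fin (n + 1), i ≤ j → x i ≤ x j)
    {Ω : Type*} [MeasurableSpace Ω] (μ : Measure Ω) [IsProbabilityMeasure μ]
    (g : Ω → EuclideanSpace ℝ (Fin (n + 1)))
    (hgint : Integrable g μ)
    (hgmean : ∫ ω, g ω ∂μ = gradient (Qfun ρ n) x)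
    (hgbdd : ∀ᵐ ω ∂μ, ‖g ω‖ ^ 2 ≤ 64 * (ρmax + M) ^ 4)
    (β : ℝ) (hβ : β = α / (16 * (ρmax + M) ^ 2))
    (hnext : ∀ᵐ ω ∂μ, (∀ i, (x - β • g ω) i ∈ Set.Icc (0 : ℝ) 1)
      ∧ (∀ i j : Fin (n + 1), i ≤ j → (x - β • g ω) i ≤ (x - β • g ω) j)) :
    (∫ ω, Qfun ρ n (x - β • g ω) ∂μ) - Qfun ρ n xs
      ≤ (1 - α / (4 * ((n : ℝ) + 1) ^ 2 * (ρmax + M) ^ 2)) * (Qfun ρ n x - Qfun ρ n xs)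
        + (4 * ρmax ^ 2 + 2 * K * ρmax) * α ^ 2 / 4 := by
  have hc : Continuous ρ := hρdiff.continuous
  have hKb : ∀ z ∈ Set.Icc (0 : ℝ) 1, |deriv ρ z| ≤ K := by
    intro z hz
    have hcd : Continuous fun z : Set.Icc (0 : ℝ) 1 => |deriv ρ (z : ℝ)| :=
      ((hρdiff.continuous_deriv (le_refl _)).comp continuous_subtype_val).abs
    rw [hK]
    exact le_ciSup (f := fun z : Set.Icc (0 : ℝ) 1 => |deriv ρ (z : ℝ)|)
      (isCompact_range hcd).bddAbove ⟨z, hz⟩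
  have hK0 : 0 ≤ K := (abs_nonneg _).trans (hKb 0 (by simp))
  set S := ρmax + M with hS
  have hS1 : 1 ≤ S := by linarith
  have hβ0 : 0 ≤ β := by rw [hβ]; positivity
  set G := gradient (Qfun ρ n) x with hG
  set L := 4 * ρmax ^ 2 + 2 * K * ρmax with hL
  have hL0 : 0 ≤ L := by positivity
  have hβ2 : β ^ 2 * (64 * S ^ 4) = α ^ 2 / 4 := by
    rw [hβ]; field_simp; ring
  -- pointwise bound
  have hpt : ∀ᵐ ω ∂μ, Qfun ρ n (x - β • g ω)
      ≤ Qfun ρ n x - β * inner ℝ G (g ω) + L * (α ^ 2 / 4) := by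
    filter_upwards [hgbdd, hnext] with ω h1 h2
    have h := Q_step hρdiff hρ hKb n x (x - β • g ω) hx01 h2.1 hxmono
    have e : x - β • g ω - x = -(β • g ω) := by abel
    rw [e, norm_neg, norm_smul, inner_neg_right, inner_smul_right, mul_pow, Real.norm_eq_abs,
      sq_abs] at h
    have h3 := mul_le_mul_of_nonneg_left h1 (sq_nonneg β)
    rw [hβ2] at h3
    have h4 := mul_le_mul_of_nonneg_left h3 hL0
    linarith
  have hQc : Continuous (Qfun ρ n) := by
    have hF : Continuous (Fint ρ) :=
      continuous_iff_continuousAt.2 fun t => (Fint_hasDeriv hc t).continuousAt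
    unfold Qfun
    fun_prop
  have hQ0 : ∀ y, 0 ≤ Qfun ρ n y := by
    intro y; unfold Qfun; positivity
  have hint : Integrable (fun ω => Qfun ρ n x - β * inner ℝ G (g ω) + L * (α ^ 2 / 4)) μ :=
    ((integrable_const _).sub ((hgint.const_inner G).const_mul β)).add (integrable_const _)
  have hQint : Integrable (fun ω => Qfun ρ n (x - β • g ω)) μ := by
    refine hint.mono' ?_ ?_
    · exact hQc.comp_aestronglyMeasurable
        (aestronglyMeasurable_const.sub (hgint.aestronglyMeasurable.const_smul β))
    · filter_upwards [hpt] with ω h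
      rwa [Real.norm_eq_abs, abs_of_nonneg (hQ0 _)]
  have hE : ∫ ω, Qfun ρ n (x - β • g ω) ∂μ ≤ Qfun ρ n x - β * ‖G‖ ^ 2 + L * (α ^ 2 / 4) := by
    refine (integral_mono_ae hQint hint hpt).trans (le_of_eq ?_)
    have hi : Integrable (fun ω => Qfun ρ n x - β * inner ℝ G (g ω)) μ :=
      (integrable_const _).sub ((hgint.const_inner G).const_mul β)
    rw [integral_add hi (integrable_const _), integral_sub (integrable_const _) ((hgint.const_inner G).const_mul β),
      MeasureTheory.integral_const_mul, integral_inner hgint, hgmean, real_inner_self_eq_norm_sq]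
    simp
  -- gradient domination
  have hPL : Qfun ρ n x - Qfun ρ n xs ≤ ((n : ℝ) + 1) ^ 2 / 4 * ‖G‖ ^ 2 := by
    have h1 := PL (Fint ρ 1) (fun j => Fint ρ (x j)) (fun i => Fint ρ (xs i) - Fint ρ (x i))
    have h2 := Q_expand ρ n x xs
    have h3 : ∑ i, pcoef (Fint ρ 1) (fun j => Fint ρ (x j)) i ^ 2 ≤ ‖G‖ ^ 2 := by
      rw [hG, (Q_grad hc n x).gradient, EuclideanSpace.norm_sq_eq]
      refine Finset.sum_le_sum fun i _ => ?_
      simp only [Real.norm_eq_abs, sq_abs, mul_pow]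
      have : 1 ≤ ρ (x i) ^ 2 := one_le_pow₀ (hρ (x i)).1
      nlinarith [sq_nonneg (pcoef (Fint ρ 1) (fun j => Fint ρ (x j)) i)]
    have h4 := mul_le_mul_of_nonneg_left h3 (by positivity : 0 ≤ ((n : ℝ) + 1) ^ 2 / 4)
    linarith
  have hfac : α / (4 * ((n : ℝ) + 1) ^ 2 * S ^ 2) * (((n : ℝ) + 1) ^ 2 / 4 * ‖G‖ ^ 2)
      = β * ‖G‖ ^ 2 := by
    rw [hβ]; field_simp; ring
  have h5 := mul_le_mul_of_nonneg_left hPL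
    (by positivity : 0 ≤ α / (4 * ((n : ℝ) + 1) ^ 2 * S ^ 2))
  rw [hfac] at h5
  linarith
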